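/- For every integer q ≥ 3, every s ∈ ℕ and every collection Y_s ∈ 𝕐_s, there exist a function f ∈ Δ^(q)(Y_s) ∩ W^{q−2} and a constant C > 0 (depending only on q and Y_s) such that E_n^(q)(f, Y_s) ≥ C for all n ∈ ℕ. -/

import Mathlib

noncomputable section

/-- A collection `Y_s ∈ 𝕐_s`: points `y 1 > y 2 > ⋯ > y (2s)` (decreasing in the index),
with the convention `y 0 = y (2s) + 2π`. -/
structure PtsColl (s : ℕ) where
  y : ℕ → ℝ
  lt : ∀ i : ℕ, 1 ≤ i → i ≤ 2 * s → y i < y (i - 1)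
  per : y 0 = y (2 * s) + 2 * Real.pi

/-- `f` is `q`-monotone (for `q ≥ 3`) on `[a,b]`: `f` is continuous on `[a,b]`,
`(q-2)`-times continuously differentiable on `(a,b)`, and `f^{(q-2)}` is convex on `(a,b)`. -/
def QMonotoneOn (q : ℕ) (f : ℝ → ℝ) (a b : ℝ) : Prop :=
  ContinuousOn f (Set.Icc a b) ∧
  ContDiffOn ℝ (q - 2 : ℕ) f (Set.Ioo a b) ∧
  ConvexOn ℝ (Set.Ioo a b) (iteratedDerivWithin (q - 2) f (Set.Ioo a b))

/-- `f ∈ Δ^(q)(Y_s)`: `f` is continuous, `2π`-periodic, and `(-1)^(i-1) f` is `q`-monotone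
on `[y i, y (i-1)]` for each `i = 1, …, 2s`. -/
def DeltaQ (q s : ℕ) (Y : PtsColl s) (f : ℝ → ℝ) : Prop :=
  Continuous f ∧ (∀ x : ℝ, f (x + 2 * Real.pi) = f x) ∧
  ∀ i : ℕ, 1 ≤ i → i ≤ 2 * s →
    QMonotoneOn q (fun x => (-1 : ℝ) ^ (i - 1) * f x) (Y.y i) (Y.y (i - 1))

/-- `T ∈ 𝒯_n`: a real trigonometric polynomial of degree at most `n`. -/
def IsTrigPoly (n : ℕ) (T : ℝ → ℝ) : Prop :=
  ∃ a b : ℕ → ℝ, ∀ t : ℝ,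
    T t = a 0 + ∑ k ∈ Finset.Icc 1 n, (a k * Real.cos (k * t) + b k * Real.sin (k * t))

/-- `f ∈ W^r`: `f` is `2π`-periodic, of class `C^{r-1}`, `f^{(r-1)}` is absolutely continuous
(being the integral of a locally integrable function `g = f^{(r)}`), and `esssup |f^{(r)}| ≤ 2`. -/
def SobolevW (r : ℕ) (f : ℝ → ℝ) : Prop :=
  (∀ x : ℝ, f (x + 2 * Real.pi) = f x) ∧
  ContDiff ℝ (r - 1 : ℕ) f ∧
  ∃ g : ℝ → ℝ,
    (∀ a b : ℝ, IntervalIntegrable g MeasureTheory.volume a b) ∧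
    (∀ᵐ x ∂MeasureTheory.volume, |g x| ≤ 2) ∧
    ∀ x : ℝ, iteratedDeriv (r - 1) f x =
      iteratedDeriv (r - 1) f 0 + ∫ t in (0 : ℝ)..x, g t

/-- `E_n^(q)(f, Y_s)`: the error of the best co-`q`-monotone approximation of `f`
by trigonometric polynomials of degree at most `n` belonging to `Δ^(q)(Y_s)`. -/
def ErrCoQ (q n s : ℕ) (Y : PtsColl s) (f : ℝ → ℝ) : ℝ :=
  sInf ((fun T => ⨆ x : ℝ, |f x - T x|) '' {T : ℝ → ℝ | IsTrigPoly n T ∧ DeltaQ q s Y T})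

open MeasureTheory in
/-- A measurable, locally integrable, `2π`-periodic function of mean zero. -/
structure IsMeanFree (u : ℝ → ℝ) : Prop where
  measurable : Measurable u
  periodic : Function.Periodic u (2 * Real.pi)
  intervalIntegrable : ∀ a b : ℝ, IntervalIntegrable u volume a b
  integral_eq_zero : ∫ t in (0 : ℝ)..2 * Real.pi, u t = 0

/-- The primitive of `u` that has mean zero on `[0, 2π]`. -/
def meanFreePrimitive (u : ℝ → ℝ) (x : ℝ) : ℝ :=
  (∫ t in (0 : ℝ)..x, u t) -
    (2 * Real.pi)⁻¹ * ∫ y in (0 : ℝ)..2 * Real.pi, ∫ t in (0 : ℝ)..y, u t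

namespace IsMeanFree

variable {u : ℝ → ℝ}

theorem continuous_meanFreePrimitive (hu : IsMeanFree u) : Continuous (meanFreePrimitive u) :=
  (intervalIntegral.continuous_primitive hu.intervalIntegrable 0).sub continuous_const

theorem primitive (hu : IsMeanFree u) : IsMeanFree (meanFreePrimitive u) where
  measurable := hu.continuous_meanFreePrimitive.measurable
  periodic x := by
    have h1 := intervalIntegral.integral_add_adjacent_intervals
      (hu.intervalIntegrable 0 x) (hu.intervalIntegrable x (x + 2 * Real.pi))
    have h2 := hu.periodic.intervalIntegral_add_eq x 0
    rw [zero_add, hu.integral_eq_zero] at h2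
    simp only [meanFreePrimitive]
    rw [← h1, h2, add_zero]
  intervalIntegrable a b := hu.continuous_meanFreePrimitive.intervalIntegrable a b
  integral_eq_zero := by
    have hc := intervalIntegral.continuous_primitive hu.intervalIntegrable 0
    simp only [meanFreePrimitive]
    rw [intervalIntegral.integral_sub (hc.intervalIntegrable _ _) intervalIntegrable_const,
      intervalIntegral.integral_const]
    have := Real.pi_pos
    simp only [smul_eq_mul]
    field_simp
    ring

theorem hasDerivAt_meanFreePrimitive (hu : IsMeanFree u) {x : ℝ} (hx : ContinuousAt u x) :
    HasDerivAt (meanFreePrimitive u) (u x) x :=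
  (intervalIntegral.integral_hasDerivAt_right (hu.intervalIntegrable 0 x)
    hu.measurable.stronglyMeasurable.stronglyMeasurableAtFilter hx).sub_const _

theorem iterate (hu : IsMeanFree u) (k : ℕ) : IsMeanFree (meanFreePrimitive^[k] u) := by
  induction k with
  | zero => exact hu
  | succ k ih =>
    rw [Function.iterate_succ_apply']
    exact ih.primitive

theorem continuous_iterate (hu : IsMeanFree u) {k : ℕ} (hk : k ≠ 0) :
    Continuous (meanFreePrimitive^[k] u) := by
  obtain ⟨k, rfl⟩ := Nat.exists_eq_succ_of_ne_zero hk
  rw [Function.iterate_succ_apply']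
  exact (hu.iterate k).continuous_meanFreePrimitive

theorem hasDerivAt_iterate (hu : IsMeanFree u) (k : ℕ) {x : ℝ} (hx : ContinuousAt u x) :
    HasDerivAt (meanFreePrimitive^[k + 1] u) (meanFreePrimitive^[k] u x) x := by
  rw [Function.iterate_succ_apply']
  refine (hu.iterate k).hasDerivAt_meanFreePrimitive ?_
  rcases eq_or_ne k 0 with rfl | hk
  · exact hx
  · exact (hu.continuous_iterate hk).continuousAt

theorem hasDerivAt_iterate_of_ne_zero (hu : IsMeanFree u) {k : ℕ} (hk : k ≠ 0) (x : ℝ) :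
    HasDerivAt (meanFreePrimitive^[k + 1] u) (meanFreePrimitive^[k] u x) x := by
  rw [Function.iterate_succ_apply']
  exact (hu.iterate k).hasDerivAt_meanFreePrimitive (hu.continuous_iterate hk).continuousAt

end IsMeanFree

/-- A finite sequence of functions, each the derivative of the previous one on an open set,
consists of the iterated derivatives of its first member. -/
theorem contDiffOn_and_iteratedDeriv_eqOn_of_hasDerivAt {S : Set ℝ} (hS : IsOpen S) (r : ℕ)
    (F : ℕ → ℝ → ℝ) (hF : ∀ k < r, ∀ x ∈ S, HasDerivAt (F k) (F (k + 1) x) x)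
    (hr : ContinuousOn (F r) S) :
    ContDiffOn ℝ r (F 0) S ∧ Set.EqOn (iteratedDeriv r (F 0)) (F r) S := by
  induction r generalizing F with
  | zero => exact ⟨contDiffOn_zero.2 hr, fun x _ => by simp⟩
  | succ r ih =>
    obtain ⟨h1, h2⟩ := ih (fun k => F (k + 1)) (fun k hk => hF (k + 1) (by omega)) hr
    have hd : Set.EqOn (deriv (F 0)) (F 1) S := fun x hx => (hF 0 (by omega) x hx).deriv
    constructor
    · rw [Nat.cast_succ, contDiffOn_succ_iff_deriv_of_isOpen hS]
      refine ⟨fun x hx => (hF 0 (by omega) x hx).differentiableAt.differentiableWithinAt,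
        by simp, h1.congr hd⟩
    · intro x hx
      rw [iteratedDeriv_succ', (hd.eventuallyEq_of_mem (hS.mem_nhds hx)).iteratedDeriv_eq]
      exact h2 hx

/-- If a function is bounded by `ε` on an interval, then each of its derivatives is `O(ε)` at some
point of that interval, with a constant that depends only on the order and on the interval. -/
theorem exists_abs_deriv_le_of_abs_le (r : ℕ) : ∀ a b : ℝ, a < b → ∃ K : ℝ, 0 ≤ K ∧
    ∀ F : ℕ → ℝ → ℝ, (∀ k < r, ∀ x ∈ Set.Ioo a b, HasDerivAt (F k) (F (k + 1) x) x) →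
      ∀ ε : ℝ, (∀ x ∈ Set.Ioo a b, |F 0 x| ≤ ε) → ∃ ξ ∈ Set.Ioo a b, |F r ξ| ≤ K * ε := by
  induction r with
  | zero =>
    intro a b hab
    refine ⟨1, zero_le_one, fun F _ ε hε => ?_⟩
    obtain ⟨x, hx⟩ := exists_between hab
    exact ⟨x, hx, by simpa using hε x hx⟩
  | succ r ih =>
    intro a b hab
    obtain ⟨c, hac, hcb⟩ := exists_between hab
    obtain ⟨d, hcd, hdb⟩ := exists_between hcb
    obtain ⟨K₁, hK₁, H₁⟩ := ih a c hac
    obtain ⟨K₂, hK₂, H₂⟩ := ih d b hdb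
    have hpos : 0 < d - c := sub_pos.2 hcd
    refine ⟨(K₁ + K₂) / (d - c), by positivity, fun F hF ε hε => ?_⟩
    obtain ⟨x, hx, hxK⟩ := H₁ F
      (fun k hk x hx => hF k (by omega) x ⟨hx.1, hx.2.trans hcb⟩) ε
      (fun x hx => hε x ⟨hx.1, hx.2.trans hcb⟩)
    obtain ⟨y, hy, hyK⟩ := H₂ F
      (fun k hk x hx => hF k (by omega) x ⟨(hac.trans hcd).trans hx.1, hx.2⟩) ε
      (fun x hx => hε x ⟨(hac.trans hcd).trans hx.1, hx.2⟩)
    have hxy : d - c ≤ y - x := by linarith [hx.2, hy.1]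
    have hsub : ∀ z ∈ Set.Icc x y, HasDerivAt (F r) (F (r + 1) z) z := fun z hz =>
      hF r (by omega) z ⟨hx.1.trans_le hz.1, hz.2.trans_lt hy.2⟩
    obtain ⟨ξ, hξ, h⟩ := exists_hasDerivAt_eq_slope (F r) (F (r + 1)) (by linarith : x < y)
      (fun z hz => (hsub z hz).continuousAt.continuousWithinAt)
      (fun z hz => hsub z (Set.Ioo_subset_Icc_self hz))
    refine ⟨ξ, ⟨hx.1.trans hξ.1, hξ.2.trans hy.2⟩, ?_⟩
    rw [h, abs_div, abs_of_pos (hpos.trans_le hxy), div_mul_eq_mul_div]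
    have hnum : |F r y - F r x| ≤ (K₁ + K₂) * ε :=
      (abs_sub _ _).trans (by linarith)
    gcongr
    exact (abs_nonneg _).trans hnum

/-- The step function of period `2π` and mean zero that jumps from `θ - 1` to `θ`
inside each period `[a, a + 2π)`, at the point `a + 2πθ`. -/
def periodicStep (a θ x : ℝ) : ℝ :=
  θ - if Int.fract ((x - a) / (2 * Real.pi)) < θ then 1 else 0

theorem periodicStep_of_mem_left {a θ x : ℝ} (hθ : θ ≤ 1)
    (hx : x ∈ Set.Ico a (a + 2 * Real.pi * θ)) : periodicStep a θ x = θ - 1 := by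
  have hp := Real.two_pi_pos
  have h0 : 0 ≤ (x - a) / (2 * Real.pi) := div_nonneg (by linarith [hx.1]) hp.le
  have h1 : (x - a) / (2 * Real.pi) < θ := by
    rw [div_lt_iff₀ hp]
    linarith [hx.2]
  rw [periodicStep, Int.fract_eq_self.2 ⟨h0, h1.trans_le hθ⟩, if_pos h1]

theorem periodicStep_of_mem_right {a θ x : ℝ} (hθ : 0 ≤ θ)
    (hx : x ∈ Set.Ico (a + 2 * Real.pi * θ) (a + 2 * Real.pi)) : periodicStep a θ x = θ := by
  have hp := Real.two_pi_pos
  have h0 : θ ≤ (x - a) / (2 * Real.pi) := by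
    rw [le_div_iff₀ hp]
    linarith [hx.1]
  have h1 : (x - a) / (2 * Real.pi) < 1 := by
    rw [div_lt_iff₀ hp]
    linarith [hx.2]
  rw [periodicStep, Int.fract_eq_self.2 ⟨hθ.trans h0, h1⟩, if_neg h0.not_gt, sub_zero]

theorem abs_periodicStep_le {a θ : ℝ} (h0 : 0 ≤ θ) (h1 : θ ≤ 1) (x : ℝ) :
    |periodicStep a θ x| ≤ 1 := by
  rw [periodicStep, abs_le]
  split_ifs <;> constructor <;> linarith

theorem isMeanFree_periodicStep {a θ : ℝ} (h0 : 0 ≤ θ) (h1 : θ ≤ 1) :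
    IsMeanFree (periodicStep a θ) := by
  have hp := Real.two_pi_pos
  have hm : Measurable (periodicStep a θ) := by
    refine measurable_const.sub (Measurable.ite ?_ measurable_const measurable_const)
    exact measurableSet_lt
      (measurable_fract.comp ((measurable_id.sub_const a).div_const _)) measurable_const
  have hper : Function.Periodic (periodicStep a θ) (2 * Real.pi) := fun x => by
    have : (x + 2 * Real.pi - a) / (2 * Real.pi) = (x - a) / (2 * Real.pi) + 1 := by
      field_simp
      ring
    rw [periodicStep, this, Int.fract_add_one, periodicStep]
  have hint : ∀ b c : ℝ, IntervalIntegrable (periodicStep a θ) MeasureTheory.volume b c :=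
    fun b c => (intervalIntegrable_const (c := (1 : ℝ))).mono_fun hm.aestronglyMeasurable
      (Filter.Eventually.of_forall fun x => by simpa using abs_periodicStep_le h0 h1 x)
  refine ⟨hm, hper, hint, ?_⟩
  have hshift := hper.intervalIntegral_add_eq 0 a
  rw [zero_add] at hshift
  have hl : a ≤ a + 2 * Real.pi * θ := by nlinarith
  have hr : a + 2 * Real.pi * θ ≤ a + 2 * Real.pi := by nlinarith
  rw [hshift, ← intervalIntegral.integral_add_adjacent_intervals
      (hint a (a + 2 * Real.pi * θ)) (hint _ _),
    intervalIntegral.integral_congr_Ioo_of_le hl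
      (g := fun _ => θ - 1)
      (fun x hx => periodicStep_of_mem_left h1 (Set.Ioo_subset_Ico_self hx)),
    intervalIntegral.integral_congr_Ioo_of_le hr
      (g := fun _ => θ)
      (fun x hx => periodicStep_of_mem_right h0 (Set.Ioo_subset_Ico_self hx))]
  simp only [intervalIntegral.integral_const, smul_eq_mul]
  ring

theorem continuousAt_periodicStep {a θ x : ℝ} (h0 : 0 ≤ θ) (h1 : θ ≤ 1)
    (hx : x ∈ Set.Ioo a (a + 2 * Real.pi * θ) ∪
      Set.Ioo (a + 2 * Real.pi * θ) (a + 2 * Real.pi)) :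
    ContinuousAt (periodicStep a θ) x := by
  rcases hx with hx | hx
  · refine (continuousAt_const (y := θ - 1)).congr ?_
    filter_upwards [isOpen_Ioo.mem_nhds hx] with t ht
    exact (periodicStep_of_mem_left h1 (Set.Ioo_subset_Ico_self ht)).symm
  · refine (continuousAt_const (y := θ)).congr ?_
    filter_upwards [isOpen_Ioo.mem_nhds hx] with t ht
    exact (periodicStep_of_mem_right h0 (Set.Ioo_subset_Ico_self ht)).symm

theorem IsTrigPoly.contDiff {n : ℕ} {T : ℝ → ℝ} (hT : IsTrigPoly n T) (m : WithTop ℕ∞) :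
    ContDiff ℝ m T := by
  obtain ⟨a, b, h⟩ := hT
  rw [funext h]
  fun_prop

theorem PtsColl.y_le_y {s : ℕ} (Y : PtsColl s) {i j : ℕ} (hij : i ≤ j) (hj : j ≤ 2 * s) :
    Y.y j ≤ Y.y i := by
  induction j, hij using Nat.le_induction with
  | base => exact le_rfl
  | succ j _ ih => exact (Y.lt (j + 1) (by omega) hj).le.trans (ih (by omega))

/-- If the derivative of `h` is antitone to the left of `c` and monotone to the right of it, then
`h` cannot increase steeply across `c`. -/
theorem sub_le_of_deriv_le_at_ends {h : ℝ → ℝ} {a b c ξ ξ' η η' M : ℝ}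
    (hh : Differentiable ℝ h) (hl : AntitoneOn (deriv h) (Set.Ioo a c))
    (hr : MonotoneOn (deriv h) (Set.Ioo c b)) (ha : a < η') (hη' : η' < ξ') (hξ' : ξ' < c)
    (hξ : c < ξ) (hη : ξ < η) (hb : η < b) (hM : deriv h η ≤ M) (hM' : deriv h η' ≤ M) :
    h ξ - h ξ' ≤ M * (ξ - ξ') := by
  obtain ⟨t, ht, e⟩ := exists_deriv_eq_slope h hξ hh.continuous.continuousOn hh.differentiableOn
  obtain ⟨t', ht', e'⟩ :=
    exists_deriv_eq_slope h hξ' hh.continuous.continuousOn hh.differentiableOn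
  have ht1 : deriv h t ≤ M := (hr ⟨ht.1, by linarith [ht.2]⟩ ⟨by linarith, hb⟩
    (by linarith [ht.2])).trans hM
  have ht2 : deriv h t' ≤ M := (hl ⟨ha, by linarith⟩ ⟨by linarith [ht'.1], ht'.2⟩
    (by linarith [ht'.1])).trans hM'
  rw [e, div_le_iff₀ (by linarith)] at ht1
  rw [e', div_le_iff₀ (by linarith)] at ht2
  linarith

/-- A trigonometric polynomial `T`, being smooth, has `T^(q-1)` monotone where `T` is
`q`-monotone. -/
theorem QMonotoneOn.monotoneOn_deriv {q : ℕ} {T : ℝ → ℝ} {a b : ℝ} (hT : ContDiff ℝ ⊤ T)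
    (h : QMonotoneOn q T a b) : MonotoneOn (deriv (iteratedDeriv (q - 2) T)) (Set.Ioo a b) := by
  refine (h.2.2.congr (iteratedDerivWithin_of_isOpen isOpen_Ioo)).monotoneOn_deriv fun x _ => ?_
  exact (hT.differentiable_iteratedDeriv (q - 2) (WithTop.coe_lt_top _)).differentiableAt

/-- On an interval where the bounded function `u` is a constant `v`, the `k`-th derivatives with
`k = r, r + 1` of a good approximant of the `r`-fold primitive of `u` are close to `v` and `0`. -/
theorem IsMeanFree.exists_abs_iteratedDeriv_sub_le {u : ℝ → ℝ} (hu : IsMeanFree u) (r : ℕ)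
    {a b v : ℝ} (hab : a < b) (hv : ∀ x ∈ Set.Ioo a b, u x = v) :
    ∃ K : ℝ, 0 ≤ K ∧ ∀ (T : ℝ → ℝ) (ε : ℝ), ContDiff ℝ ⊤ T →
      (∀ x, |meanFreePrimitive^[r] u x - T x| ≤ ε) →
      (∃ ξ ∈ Set.Ioo a b, |iteratedDeriv r T ξ - v| ≤ K * ε) ∧
      ∃ η ∈ Set.Ioo a b, |deriv (iteratedDeriv r T) η| ≤ K * ε := by
  obtain ⟨K₁, hK₁, H₁⟩ := exists_abs_deriv_le_of_abs_le r a b hab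
  obtain ⟨K₂, hK₂, H₂⟩ := exists_abs_deriv_le_of_abs_le (r + 1) a b hab
  refine ⟨max K₁ K₂, le_max_of_le_left hK₁, fun T ε hT hε => ?_⟩
  have hε0 : 0 ≤ ε := (abs_nonneg _).trans (hε 0)
  have hTd : ∀ k x, HasDerivAt (iteratedDeriv k T) (iteratedDeriv (k + 1) T x) x := fun k x => by
    rw [iteratedDeriv_succ]
    exact (hT.differentiable_iteratedDeriv k (WithTop.coe_lt_top _)).differentiableAt.hasDerivAt
  have hu' : ∀ x ∈ Set.Ioo a b, u =ᶠ[nhds x] fun _ => v := fun x hx =>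
    Filter.eventually_of_mem (isOpen_Ioo.mem_nhds hx) hv
  let F : ℕ → ℝ → ℝ := fun k x => iteratedDeriv k T x -
    if k ≤ r then meanFreePrimitive^[r - k] u x else 0
  have hF : ∀ k < r + 1, ∀ x ∈ Set.Ioo a b, HasDerivAt (F k) (F (k + 1) x) x := by
    intro k hk x hx
    refine (hTd k x).sub ?_
    rcases Nat.lt_succ_iff_lt_or_eq.1 hk with hk | rfl
    · have e : r - k = r - (k + 1) + 1 := by omega
      simp only [if_pos hk.le, if_pos (Nat.succ_le_of_lt hk)]
      rw [e]
      exact hu.hasDerivAt_iterate _ (continuousAt_const.congr (hu' x hx).symm)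
    · simp only [le_refl, if_true, tsub_self, Function.iterate_zero, id_eq,
        if_neg (Nat.not_succ_le_self k)]
      exact (hasDerivAt_const x v).congr_of_eventuallyEq (hu' x hx)
  have hF0 : ∀ x ∈ Set.Ioo a b, |F 0 x| ≤ ε := fun x _ => by
    simpa [F, abs_sub_comm] using hε x
  obtain ⟨ξ, hξ, h₁⟩ := H₁ F (fun k hk => hF k (by omega)) ε hF0
  obtain ⟨η, hη, h₂⟩ := H₂ F hF ε hF0
  refine ⟨⟨ξ, hξ, ?_⟩, η, hη, ?_⟩
  · simp only [F, le_refl, if_true, tsub_self, Function.iterate_zero, id_eq, hv ξ hξ] at h₁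
    exact h₁.trans (by gcongr; exact le_max_left _ _)
  · simp only [F, if_neg (Nat.not_succ_le_self r), sub_zero, iteratedDeriv_succ] at h₂
    exact h₂.trans (by gcongr; exact le_max_right _ _)

theorem deltaQ_zero (q s : ℕ) (Y : PtsColl s) : DeltaQ q s Y fun _ => 0 := by
  refine ⟨continuous_const, fun _ => rfl, fun i _ _ => ?_⟩
  simp only [mul_zero]
  refine ⟨continuousOn_const, contDiffOn_const, ?_⟩
  have : iteratedDerivWithin (q - 2) (fun _ : ℝ => (0 : ℝ)) (Set.Ioo (Y.y i) (Y.y (i - 1))) =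
      fun _ => 0 := by
    ext x
    simp
  rw [this]
  exact convexOn_const 0 (convex_Ioo _ _)

theorem isTrigPoly_zero (n : ℕ) : IsTrigPoly n fun _ => 0 :=
  ⟨0, 0, fun t => by simp⟩

/-- A primitive of order `q - 2` of a function which is constant between the points of `Y`
is co-`q`-monotone. -/
theorem IsMeanFree.deltaQ_iterate {u : ℝ → ℝ} (hu : IsMeanFree u) {q s : ℕ} (hq : 3 ≤ q)
    (Y : PtsColl s)
    (hY : ∀ i, 1 ≤ i → i ≤ 2 * s → ∃ v, ∀ x ∈ Set.Ioo (Y.y i) (Y.y (i - 1)), u x = v) :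
    DeltaQ q s Y (meanFreePrimitive^[q - 2] u) := by
  have hcont : Continuous (meanFreePrimitive^[q - 2] u) := hu.continuous_iterate (by omega)
  refine ⟨hcont, (hu.iterate _).periodic, fun i hi hi' => ?_⟩
  obtain ⟨v, hv⟩ := hY i hi hi'
  set σ : ℝ := (-1) ^ (i - 1)
  have hu' : ∀ x ∈ Set.Ioo (Y.y i) (Y.y (i - 1)), ContinuousAt u x := fun x hx =>
    continuousAt_const.congr (Filter.eventually_of_mem (isOpen_Ioo.mem_nhds hx)
      fun t ht => (hv t ht).symm)
  obtain ⟨h1, h2⟩ := contDiffOn_and_iteratedDeriv_eqOn_of_hasDerivAt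
    (isOpen_Ioo (a := Y.y i) (b := Y.y (i - 1))) (q - 2)
    (fun k x => σ * meanFreePrimitive^[q - 2 - k] u x)
    (fun k hk x hx => by
      have e : q - 2 - k = q - 2 - (k + 1) + 1 := by omega
      rw [e]
      exact (hu.hasDerivAt_iterate _ (hu' x hx)).const_mul σ)
    (fun x hx => by
      simp only [tsub_self, Function.iterate_zero, id_eq]
      exact ((hu' x hx).const_mul σ).continuousWithinAt)
  refine ⟨(continuous_const.mul hcont).continuousOn, h1, ?_⟩
  refine (convexOn_const (σ * v) (convex_Ioo _ _)).congr fun x hx => ?_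
  rw [iteratedDerivWithin_of_isOpen isOpen_Ioo hx]
  refine Eq.trans ?_ (h2 hx).symm
  simp [hv x hx]

theorem IsMeanFree.sobolevW_iterate {u : ℝ → ℝ} (hu : IsMeanFree u) {r : ℕ} (hr : 1 ≤ r)
    (hb : ∀ x, |u x| ≤ 2) : SobolevW r (meanFreePrimitive^[r] u) := by
  obtain ⟨h1, h2⟩ := contDiffOn_and_iteratedDeriv_eqOn_of_hasDerivAt
    isOpen_univ (r - 1) (fun k => meanFreePrimitive^[r - k] u)
    (fun k hk x _ => by
      have e : r - k = r - (k + 1) + 1 := by omega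
      rw [e]
      exact hu.hasDerivAt_iterate_of_ne_zero (by omega) x)
    (hu.continuous_iterate (by omega)).continuousOn
  refine ⟨(hu.iterate r).periodic, contDiffOn_univ.1 h1, u, hu.intervalIntegrable,
    Filter.Eventually.of_forall hb, fun x => ?_⟩
  have e : r - (r - 1) = 1 := by omega
  have h3 : ∀ y, iteratedDeriv (r - 1) (meanFreePrimitive^[r] u) y = meanFreePrimitive u y :=
    fun y => by simpa [e] using h2 (Set.mem_univ y)
  rw [h3, h3]
  simp only [meanFreePrimitive, intervalIntegral.integral_same]
  ring

/-- A mean-free function that jumps upwards across `Y.y 1` has a primitive of order `q - 2` that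
smooth co-`q`-monotone functions do not approximate. -/
theorem IsMeanFree.exists_le_of_abs_sub_le {u : ℝ → ℝ} (hu : IsMeanFree u) (q : ℕ) {s : ℕ}
    (hs : 1 ≤ s) (Y : PtsColl s) {v w : ℝ} (hvw : v < w)
    (hv : ∀ x ∈ Set.Ioo (Y.y 2) (Y.y 1), u x = v)
    (hw : ∀ x ∈ Set.Ioo (Y.y 1) (Y.y 0), u x = w) :
    ∃ C : ℝ, 0 < C ∧ ∀ (T : ℝ → ℝ) (ε : ℝ), ContDiff ℝ ⊤ T → DeltaQ q s Y T →
      (∀ x, |meanFreePrimitive^[q - 2] u x - T x| ≤ ε) → C ≤ ε := by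
  have h10 : Y.y 1 < Y.y 0 := Y.lt 1 le_rfl (by omega)
  have h21 : Y.y 2 < Y.y 1 := Y.lt 2 (by omega) (by omega)
  obtain ⟨m, hm, hm'⟩ := exists_between h10
  obtain ⟨l, hl, hl'⟩ := exists_between h21
  obtain ⟨K₁, hK₁, H₁⟩ := hu.exists_abs_iteratedDeriv_sub_le (q - 2) hm
    (fun x hx => hw x ⟨hx.1, hx.2.trans hm'⟩)
  obtain ⟨K₂, hK₂, H₂⟩ := hu.exists_abs_iteratedDeriv_sub_le (q - 2) hm'
    (fun x hx => hw x ⟨hm.trans hx.1, hx.2⟩)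
  obtain ⟨K₃, hK₃, H₃⟩ := hu.exists_abs_iteratedDeriv_sub_le (q - 2) hl'
    (fun x hx => hv x ⟨hl.trans hx.1, hx.2⟩)
  obtain ⟨K₄, hK₄, H₄⟩ := hu.exists_abs_iteratedDeriv_sub_le (q - 2) hl
    (fun x hx => hv x ⟨hx.1, hx.2.trans hl'⟩)
  have hL : 0 < Y.y 0 - Y.y 2 := by linarith
  refine ⟨(w - v) / (1 + K₁ + K₃ + (K₂ + K₄) * (Y.y 0 - Y.y 2)),
    div_pos (by linarith) (by positivity), fun T ε hT hD hε => ?_⟩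
  have hε0 : 0 ≤ ε := (abs_nonneg _).trans (hε 0)
  obtain ⟨ξ, hξ, hξK⟩ := (H₁ T ε hT hε).1
  obtain ⟨η, hη, hηK⟩ := (H₂ T ε hT hε).2
  obtain ⟨ξ', hξ', hξK'⟩ := (H₃ T ε hT hε).1
  obtain ⟨η', hη', hηK'⟩ := (H₄ T ε hT hε).2
  have hmono : MonotoneOn (deriv (iteratedDeriv (q - 2) T)) (Set.Ioo (Y.y 1) (Y.y 0)) :=
    QMonotoneOn.monotoneOn_deriv hT (by simpa using hD.2.2 1 le_rfl (by omega))
  have hanti : AntitoneOn (deriv (iteratedDeriv (q - 2) T)) (Set.Ioo (Y.y 2) (Y.y 1)) := by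
    have h := QMonotoneOn.monotoneOn_deriv hT.neg
      (by simpa using hD.2.2 2 (by omega) (by omega))
    have e : deriv (iteratedDeriv (q - 2) fun x => -T x) =
        fun x => -deriv (iteratedDeriv (q - 2) T) x := by
      simp only [← iteratedDeriv_succ]
      ext x
      exact iteratedDeriv_fun_neg _ _ _
    intro x hx y hy hxy
    have := h hx hy hxy
    rw [e] at this
    exact neg_le_neg_iff.1 this
  have hle := sub_le_of_deriv_le_at_ends (M := (K₂ + K₄) * ε)
    (hT.differentiable_iteratedDeriv (q - 2) (WithTop.coe_lt_top _)) hanti hmono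
    hη'.1 (hη'.2.trans hξ'.1) hξ'.2 hξ.1 (hξ.2.trans hη.1) hη.2
    ((le_abs_self _).trans (hηK.trans (by nlinarith)))
    ((le_abs_self _).trans (hηK'.trans (by nlinarith)))
  have hlen : (K₂ + K₄) * ε * (ξ - ξ') ≤ (K₂ + K₄) * ε * (Y.y 0 - Y.y 2) := by
    gcongr
    · linarith [hξ.2]
    · linarith [hξ'.1]
  rw [div_le_iff₀ (by positivity)]
  linarith [(abs_le.1 hξK).1, (abs_le.1 hξK').2]

/-- **Theorem 1.2.** For each `q ≥ 3`, `s ∈ ℕ` and any `Y_s ∈ 𝕐_s`, there exists a function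
`f ∈ Δ^(q)(Y_s) ∩ W^{q-2}` and a constant `C = C(q, Y_s) > 0` such that
`E_n^(q)(f, Y_s) ≥ C` for all `n ∈ ℕ`. -/
theorem lower_bound_W_q_sub_two (q s : ℕ) (hq : 3 ≤ q) (hs : 1 ≤ s) (Y : PtsColl s) :
    ∃ f : ℝ → ℝ, ∃ C : ℝ, 0 < C ∧ DeltaQ q s Y f ∧ SobolevW (q - 2) f ∧
      ∀ n : ℕ, 1 ≤ n → C ≤ ErrCoQ q n s Y f := by
  have hp := Real.two_pi_pos
  have h10 : Y.y 1 < Y.y 0 := Y.lt 1 le_rfl (by omega)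
  have h21 : Y.y 2 < Y.y 1 := Y.lt 2 (by omega) (by omega)
  have hs2 : Y.y (2 * s) ≤ Y.y 2 := Y.y_le_y (by omega) le_rfl
  have hper := Y.per
  obtain ⟨θ, hθ⟩ : ∃ θ, θ = (Y.y 1 - Y.y (2 * s)) / (2 * Real.pi) := ⟨_, rfl⟩
  have hθ0 : 0 ≤ θ := hθ ▸ div_nonneg (by linarith) hp.le
  have hθ1 : θ ≤ 1 := by
    rw [hθ, div_le_one hp]
    linarith
  have hy1 : Y.y (2 * s) + 2 * Real.pi * θ = Y.y 1 := by
    rw [hθ]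
    field_simp
    ring
  have hu := isMeanFree_periodicStep (a := Y.y (2 * s)) hθ0 hθ1
  have hleft : ∀ x ∈ Set.Ioo (Y.y (2 * s)) (Y.y 1),
      periodicStep (Y.y (2 * s)) θ x = θ - 1 := fun x hx =>
    periodicStep_of_mem_left hθ1 (by rw [hy1]; exact Set.Ioo_subset_Ico_self hx)
  have hright : ∀ x ∈ Set.Ioo (Y.y 1) (Y.y 0), periodicStep (Y.y (2 * s)) θ x = θ := fun x hx =>
    periodicStep_of_mem_right hθ0 (by rw [hy1, ← hper]; exact Set.Ioo_subset_Ico_self hx)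
  have hD := hu.deltaQ_iterate hq Y fun i hi hi' => by
    rcases hi.eq_or_lt with rfl | hi
    · exact ⟨θ, hright⟩
    · exact ⟨θ - 1, fun x hx => hleft x ⟨(Y.y_le_y hi' le_rfl).trans_lt hx.1,
        hx.2.trans_le (Y.y_le_y (by omega) (by omega))⟩⟩
  obtain ⟨C, hC, H⟩ := hu.exists_le_of_abs_sub_le q hs Y (sub_one_lt θ)
    (fun x hx => hleft x ⟨hs2.trans_lt hx.1, hx.2⟩) hright
  refine ⟨_, C, hC, hD, hu.sobolevW_iterate (by omega) fun x =>
    (abs_periodicStep_le hθ0 hθ1 x).trans one_le_two, fun n _ => ?_⟩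
  refine le_csInf ⟨_, _, ⟨isTrigPoly_zero n, deltaQ_zero q s Y⟩, rfl⟩ ?_
  rintro _ ⟨T, ⟨hT, hTD⟩, rfl⟩
  refine H T _ (hT.contDiff _) hTD fun x => ?_
  have hperiodic : Function.Periodic
      (fun x => |meanFreePrimitive^[q - 2] (periodicStep (Y.y (2 * s)) θ) x - T x|)
      (2 * Real.pi) := fun x => by
    simp only [hD.2.1 x, hTD.2.1 x]
  exact le_ciSup (hperiodic.isBounded_of_continuous hp.ne' (hD.1.sub hTD.1).abs).bddAbove x
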